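/- Let (G,c) be a red-blue edge-colored graph whose underlying graph G satisfies the chord property. Then (G,c) satisfies Karzanov's property: for any two perfect matchings M and M' with r(M) ≡ r(M') (mod 2) and any integer k with r(M) ≤ k ≤ r(M') and k ≡ r(M) (mod 2), there exists a perfect matching M'' with r(M'') = k. -/

import Mathlib

variable {V : Type*} [Fintype V] [DecidableEq V]

/-- `M` is a perfect matching of `G`: every edge of `M` is an edge of `G`,
and every vertex lies in exactly one edge of `M`. -/
def IsPM (G : SimpleGraph V) (M : Finset (Sym2 V)) : Prop :=
  (∀ e ∈ M, e ∈ G.edgeSet) ∧ ∀ v : V, ∃! e, e ∈ M ∧ v ∈ e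

/-- The `M`-induced weight of an edge, for the coloring `c` (`true` = red):
`-1` for red matching edges, `+1` for red non-matching edges, `0` for blue edges. -/
def wt (c : Sym2 V → Bool) (M : Finset (Sym2 V)) (e : Sym2 V) : ℤ :=
  if c e then (if e ∈ M then -1 else 1) else 0

/-- Number of red edges of a finite edge set. -/
def redCount (c : Sym2 V → Bool) (F : Finset (Sym2 V)) : ℕ :=
  (F.filter (fun e => c e = true)).card

/-- A walk is `M`-alternating if consecutive edges have opposite membership in `M`. -/
def IsAlt (M : Finset (Sym2 V)) {G : SimpleGraph V} {u v : V} (P : G.Walk u v) : Prop :=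
  P.edges.Chain' (fun e f => (e ∈ M) ↔ f ∉ M)

/-- The `i`-th vertex (cyclically, indices mod `C.length`) along a closed walk `C`. -/
def cvtx {G : SimpleGraph V} {v : V} (C : G.Walk v v) (i : ℕ) : V :=
  C.support.tail.getD (i % C.length) v

/-- Positions `i, j` on the cycle `C` carry a chord: the corresponding vertices are
adjacent in `G` but the edge is not an edge of `C`. -/
def IsChordAt {G : SimpleGraph V} {v : V} (C : G.Walk v v) (i j : ℕ) : Prop :=
  G.Adj (cvtx C i) (cvtx C j) ∧ s(cvtx C i, cvtx C j) ∉ C.edges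

/-- `C` has an odd chord: a chord splitting `C` into two odd-length paths. -/
def HasOddChord {G : SimpleGraph V} {v : V} (C : G.Walk v v) : Prop :=
  ∃ i j : ℕ, i < j ∧ j < C.length ∧ Odd (j - i) ∧ IsChordAt C i j

/-- `C` has two adjacent odd chords: chords `{u,v₀} = {cvtx i, cvtx (i+d)}` and
`{x,y} = {cvtx (i+d+1), cvtx (i+n-1)}` whose endpoints appear in cyclic order
`u, v₀, x, y` with `{v₀,x}` and `{y,u}` edges of `C`, both chords odd. -/
def HasTwoAdjOddChords {G : SimpleGraph V} {v : V} (C : G.Walk v v) : Prop :=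
  ∃ i d : ℕ, 1 ≤ d ∧ d + 3 ≤ C.length ∧
    IsChordAt C i (i + d) ∧ (Odd d ∨ Odd (C.length - d)) ∧
    IsChordAt C (i + d + 1) (i + C.length - 1) ∧
    (Odd (C.length - d - 2) ∨ Odd (d + 2))

/-- Karzanov's property for the colored graph `(G, c)`: between any two perfect
matchings of the same parity of red edges, all intermediate values of the same
parity are attained by perfect matchings. -/
def Karzanov (G : SimpleGraph V) (c : Sym2 V → Bool) : Prop :=
  ∀ M M' : Finset (Sym2 V), IsPM G M → IsPM G M' →
    ∀ k : ℕ, redCount c M ≤ k → k ≤ redCount c M' →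
      redCount c M % 2 = k % 2 → redCount c M' % 2 = k % 2 →
      ∃ M'', IsPM G M'' ∧ redCount c M'' = k

/-- The chord property of a graph `G`. -/
def ChordProperty (G : SimpleGraph V) : Prop :=
  (∀ (v : V) (C : G.Walk v v), C.IsCycle → Even C.length → 6 ≤ C.length →
    (HasOddChord C ∨
      ∀ i j : ℕ, i < j → j < C.length → Even (j - i) → G.Adj (cvtx C i) (cvtx C j))) ∧
  (∀ (v : V) (C : G.Walk v v), C.IsCycle → Even C.length → 8 ≤ C.length →
    (HasTwoAdjOddChords C ∨
      ∀ i j : ℕ, i < j → j < C.length → Even (j - i) → 4 ≤ j - i → j - i ≤ C.length - 4 →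
        G.Adj (cvtx C i) (cvtx C j)))

set_option linter.unusedSectionVars false

/-- The sequence obtained from `v` by applying `m` and `m'` in turn. -/
def altSeq {V : Type*} (m m' : V → V) (v : V) : ℕ → V
  | 0 => v
  | n + 1 => if Even n then m (altSeq m m' v n) else m' (altSeq m m' v n)

section AltSeq

variable {m m' : V → V}

theorem altSeq_add (v : V) (i j : ℕ) :
    altSeq m m' v (i + j) = if Even i then altSeq m m' (altSeq m m' v i) j
      else altSeq m' m (altSeq m m' v i) j := by
  induction j with
  | zero => simp [altSeq]
  | succ j ih =>
    rw [← add_assoc]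
    simp only [altSeq, ih, Nat.even_add]
    split_ifs <;> tauto

theorem altSeq_succ_of_even (v : V) {i : ℕ} (hi : Even i) :
    altSeq m m' v (i + 1) = m (altSeq m m' v i) := by simp [altSeq, hi]

theorem altSeq_succ_of_odd (v : V) {i : ℕ} (hi : Odd i) :
    altSeq m m' v (i + 1) = m' (altSeq m m' v i) := by
  simp [altSeq, Nat.not_even_iff_odd.2 hi]

theorem altSeq_odd_ne (hm : ∀ v, m (m v) = v ∧ m v ≠ v) (hm' : ∀ v, m' (m' v) = v ∧ m' v ≠ v)
    (v : V) (k : ℕ) : altSeq m m' v (2 * k + 1) ≠ v := by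
  induction k generalizing m m' v with
  | zero => simpa [altSeq] using (hm v).2
  | succ k ih =>
    intro h
    rw [altSeq_succ_of_even v (by simp)] at h
    have h1 : altSeq m m' v (1 + (2 * k + 1)) = m v := by
      rw [show 1 + (2 * k + 1) = 2 * (k + 1) by ring]
      have := congrArg m h
      rwa [(hm _).1] at this
    rw [altSeq_add, if_neg (by decide)] at h1
    exact ih hm' hm (m v) (by simpa [altSeq] using h1)

theorem altSeq_ne_of_odd_sub (hm : ∀ v, m (m v) = v ∧ m v ≠ v)
    (hm' : ∀ v, m' (m' v) = v ∧ m' v ≠ v) (v : V) {i j : ℕ} (hij : i ≤ j) (h : Odd (j - i)) :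
    altSeq m m' v j ≠ altSeq m m' v i := by
  obtain ⟨k, hk⟩ := h
  obtain rfl : j = i + (2 * k + 1) := by omega
  rw [altSeq_add]
  split_ifs
  · exact altSeq_odd_ne hm hm' _ k
  · exact altSeq_odd_ne hm' hm _ k

theorem altSeq_sub_eq (hm : ∀ v, m (m v) = v ∧ m v ≠ v)
    (hm' : ∀ v, m' (m' v) = v ∧ m' v ≠ v) (v : V) {i j : ℕ} (hij : i ≤ j)
    (h : altSeq m m' v j = altSeq m m' v i) : altSeq m m' v (j - i) = v := by
  have hev : Even (j - i) := by
    by_contra hodd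
    exact altSeq_ne_of_odd_sub hm hm' v hij (Nat.not_even_iff_odd.1 hodd) h
  obtain ⟨l, rfl⟩ := Nat.exists_eq_add_of_le hij
  rw [Nat.add_sub_cancel_left] at hev ⊢
  clear hij
  induction i with
  | zero => simpa [altSeq] using h
  | succ i ih =>
    apply ih
    rw [show i + 1 + l = (i + l) + 1 by ring] at h
    by_cases hi : Even i
    · rw [altSeq_succ_of_even v hi, altSeq_succ_of_even v (hi.add hev)] at h
      rw [← (hm (altSeq m m' v (i + l))).1, h, (hm _).1]
    · rw [Nat.not_even_iff_odd] at hi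
      rw [altSeq_succ_of_odd v hi, altSeq_succ_of_odd v (hi.add_even hev)] at h
      rw [← (hm' (altSeq m m' v (i + l))).1, h, (hm' _).1]

/-- `n` is the number of vertices of the alternating cycle through `v`. -/
structure IsAltPeriod (m m' : V → V) (v : V) (n : ℕ) : Prop where
  pos : 0 < n
  even : Even n
  add_period : ∀ i, altSeq m m' v (i + n) = altSeq m m' v i
  inj : ∀ i j, i < n → j < n → altSeq m m' v i = altSeq m m' v j → i = j

theorem exists_isAltPeriod (hm : ∀ v, m (m v) = v ∧ m v ≠ v)
    (hm' : ∀ v, m' (m' v) = v ∧ m' v ≠ v) (v : V) : ∃ n, IsAltPeriod m m' v n := by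
  classical
  have hex : ∃ n, 0 < n ∧ altSeq m m' v n = v := by
    obtain ⟨i, j, hne, hij⟩ := Finite.exists_ne_map_eq_of_infinite (altSeq m m' v)
    rcases lt_or_gt_of_ne hne with h | h
    · exact ⟨j - i, by omega, altSeq_sub_eq hm hm' v h.le hij.symm⟩
    · exact ⟨i - j, by omega, altSeq_sub_eq hm hm' v h.le hij⟩
  obtain ⟨hpos, hn⟩ := Nat.find_spec hex
  have heven : Even (Nat.find hex) := by
    by_contra hodd
    exact altSeq_ne_of_odd_sub hm hm' v (Nat.zero_le (Nat.find hex))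
      (by simpa using hodd) (by simpa [altSeq] using hn)
  have key : ∀ i j, i < j → j < Nat.find hex → altSeq m m' v i ≠ altSeq m m' v j := by
    intro i j hij hj h
    exact Nat.find_min hex (m := j - i) (by omega)
      ⟨by omega, altSeq_sub_eq hm hm' v hij.le h.symm⟩
  refine ⟨Nat.find hex, hpos, heven, fun i => ?_, fun i j hi hj h => ?_⟩
  · rw [add_comm, altSeq_add, if_pos heven, hn]
  · rcases lt_trichotomy i j with hl | hl | hl
    · exact absurd h (key i j hl hj)
    · exact hl
    · exact absurd h.symm (key j i hl hi)

theorem IsAltPeriod.mod_eq {v : V} {n : ℕ} (h : IsAltPeriod m m' v n) (i : ℕ) :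
    altSeq m m' v (i % n) = altSeq m m' v i := by
  have : ∀ k, altSeq m m' v (i % n + n * k) = altSeq m m' v (i % n) := by
    intro k
    induction k with
    | zero => simp
    | succ k ih => rw [Nat.mul_succ, ← add_assoc, h.add_period, ih]
  rw [← this (i / n), Nat.mod_add_div]

/-- The vertices on the first `n` places of the alternating sequence. -/
def altSet (m m' : V → V) (v : V) (n : ℕ) : Finset V :=
  (Finset.range n).image (altSeq m m' v)

theorem IsAltPeriod.card_altSet {v : V} {n : ℕ} (h : IsAltPeriod m m' v n) :
    (altSet m m' v n).card = n := by
  rw [altSet, Finset.card_image_of_injOn, Finset.card_range]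
  intro i hi j hj hij
  exact h.inj i j (by simpa using hi) (by simpa using hj) hij

theorem IsAltPeriod.mem_altSet {v : V} {n : ℕ} (h : IsAltPeriod m m' v n) (i : ℕ) :
    altSeq m m' v i ∈ altSet m m' v n := by
  rw [← h.mod_eq]
  exact Finset.mem_image_of_mem _ (Finset.mem_range.2 (Nat.mod_lt _ h.pos))

theorem IsAltPeriod.apply_mem_altSet {v : V} {n : ℕ} (h : IsAltPeriod m m' v n)
    (hm : ∀ v, m (m v) = v) (hm' : ∀ v, m' (m' v) = v) {x : V} (hx : x ∈ altSet m m' v n) :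
    m x ∈ altSet m m' v n ∧ m' x ∈ altSet m m' v n := by
  obtain ⟨i, -, rfl⟩ := Finset.mem_image.1 hx
  have hpos := h.pos
  obtain ⟨k, hk⟩ : ∃ k, k + 1 = i + n := ⟨i + n - 1, by omega⟩
  have hpar : Even i ↔ ¬ Even k := by
    have := congrArg Even hk
    simp only [Nat.even_add, h.even, Nat.even_add_one, iff_true] at this
    tauto
  by_cases hi : Even i
  · refine ⟨?_, ?_⟩
    · rw [← altSeq_succ_of_even (m := m) (m' := m') v hi]
      exact h.mem_altSet _
    · rw [← h.add_period, ← hk, altSeq_succ_of_odd v (Nat.not_even_iff_odd.1 (hpar.1 hi)), hm']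
      exact h.mem_altSet _
  · refine ⟨?_, ?_⟩
    · rw [← h.add_period, ← hk, altSeq_succ_of_even v (by tauto), hm]
      exact h.mem_altSet _
    · rw [← altSeq_succ_of_odd (m := m) (m' := m') v (Nat.not_even_iff_odd.1 hi)]
      exact h.mem_altSet _

end AltSeq

section Walk

variable {G : SimpleGraph V}

/-- The walk of length `n` along a sequence of consecutively adjacent vertices. -/
def seqWalk (p : ℕ → V) (hp : ∀ i, G.Adj (p i) (p (i + 1))) : (n : ℕ) → G.Walk (p 0) (p n)
  | 0 => SimpleGraph.Walk.nil
  | n + 1 => (seqWalk p hp n).concat (hp n)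

theorem length_seqWalk (p : ℕ → V) (hp : ∀ i, G.Adj (p i) (p (i + 1))) (n : ℕ) :
    (seqWalk p hp n).length = n := by
  induction n with
  | zero => rfl
  | succ n ih => simp [seqWalk, SimpleGraph.Walk.length_concat, ih]

theorem support_seqWalk (p : ℕ → V) (hp : ∀ i, G.Adj (p i) (p (i + 1))) (n : ℕ) :
    (seqWalk p hp n).support = (List.range (n + 1)).map p := by
  induction n with
  | zero => rfl
  | succ n ih =>
    rw [List.range_succ, List.map_append, ← ih]
    simp [seqWalk, SimpleGraph.Walk.support_concat]

theorem edge_mem_seqWalk (p : ℕ → V) (hp : ∀ i, G.Adj (p i) (p (i + 1))) (n i : ℕ) (hi : i < n) :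
    s(p i, p (i + 1)) ∈ (seqWalk p hp n).edges := by
  induction n with
  | zero => omega
  | succ n ih =>
    simp only [seqWalk, SimpleGraph.Walk.edges_concat, List.concat_eq_append, List.mem_append,
      List.mem_singleton]
    rcases Nat.lt_succ_iff_lt_or_eq.1 hi with h | rfl
    · exact Or.inl (ih h)
    · exact Or.inr rfl

theorem exists_cycle_of_seq (p : ℕ → V) (hp : ∀ i, G.Adj (p i) (p (i + 1))) (n : ℕ) (hn : 3 ≤ n)
    (hper : ∀ i, p (i + n) = p i) (hinj : ∀ i j, i < n → j < n → p i = p j → i = j) :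
    ∃ C : G.Walk (p 0) (p 0), C.IsCycle ∧ C.length = n ∧ (∀ i, cvtx C i = p (i + 1)) ∧
      ∀ i, s(p i, p (i + 1)) ∈ C.edges := by
  have h0 : p n = p 0 := by simpa using hper 0
  have hmod : ∀ i, p (i % n) = p i := by
    intro i
    have : ∀ k, p (i % n + n * k) = p (i % n) := by
      intro k
      induction k with
      | zero => simp
      | succ k ih => rw [Nat.mul_succ, ← add_assoc, hper, ih]
    rw [← this (i / n), Nat.mod_add_div]
  have hsucc : ∀ i, p (i % n + 1) = p (i + 1) := by
    intro i
    rw [← hmod (i % n + 1), ← hmod (i + 1)]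
    simp
  have hlen : ((seqWalk p hp n).copy rfl h0).length = n := by
    rw [SimpleGraph.Walk.length_copy, length_seqWalk]
  have hsup : ((seqWalk p hp n).copy rfl h0).support.tail =
      (List.range n).map (fun i => p (i + 1)) := by
    rw [SimpleGraph.Walk.support_copy, support_seqWalk, List.range_succ_eq_map]
    simp [Function.comp_def]
  refine ⟨(seqWalk p hp n).copy rfl h0, ?_, hlen, fun i => ?_, fun i => ?_⟩
  · rw [SimpleGraph.Walk.isCycle_iff_isPath_tail_and_le_length]
    refine ⟨?_, by omega⟩
    rw [SimpleGraph.Walk.isPath_def, SimpleGraph.Walk.support_tail_of_not_nil, hsup]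
    · refine (List.nodup_map_iff_inj_on List.nodup_range).2 fun i hi j hj hij => ?_
      rw [List.mem_range] at hi hj
      by_cases hi' : i + 1 = n <;> by_cases hj' : j + 1 = n
      · omega
      · rw [hi', h0] at hij
        have := hinj _ _ (by omega) (by omega) hij
        omega
      · rw [hj', h0] at hij
        have := hinj _ _ (by omega) (by omega) hij
        omega
      · have := hinj _ _ (by omega) (by omega) hij
        omega
    · intro h
      have := SimpleGraph.Walk.length_eq_zero_iff.2 h
      omega
  · have hi : i % n < n := Nat.mod_lt _ (by omega)
    rw [cvtx, hsup, hlen, List.getD_eq_getElem _ _ (by simpa using hi)]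
    simp [hsucc]
  · rw [SimpleGraph.Walk.edges_copy, ← hmod i, ← hsucc i]
    exact edge_mem_seqWalk p hp n _ (Nat.mod_lt _ (by omega))

end Walk

section MateMap

/-- `m` is a fixed-point-free involution pairing the vertices along edges of `G`. -/
def IsMateMap {V : Type*} (G : SimpleGraph V) (m : V → V) : Prop :=
  ∀ v, m (m v) = v ∧ G.Adj v (m v)

/-- Twice the total weight of the edges of the perfect matching given by `m`. -/
def mateWeight (w : Sym2 V → ℤ) (m : V → V) : ℤ := ∑ v, w s(v, m v)

variable {G : SimpleGraph V} {m m' N : V → V} {w : Sym2 V → ℤ} {K : ℤ}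

theorem IsMateMap.invol (h : IsMateMap G m) (v : V) : m (m v) = v := (h v).1

theorem IsMateMap.adj (h : IsMateMap G m) (v : V) : G.Adj v (m v) := (h v).2

theorem IsMateMap.ne (h : IsMateMap G m) (v : V) : m v ≠ v := (h v).2.ne'

theorem IsMateMap.injective (h : IsMateMap G m) : Function.Injective m :=
  Function.LeftInverse.injective h.invol

theorem IsMateMap.invol_ne (h : IsMateMap G m) (v : V) : m (m v) = v ∧ m v ≠ v :=
  ⟨h.invol v, h.ne v⟩

theorem IsMateMap.even_mateWeight (h : IsMateMap G m) (w : Sym2 V → ℤ) :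
    (2 : ℤ) ∣ mateWeight w m := by
  rw [← Nat.cast_ofNat, ← ZMod.intCast_zmod_eq_zero_iff_dvd, mateWeight, Int.cast_sum]
  refine Finset.sum_involution (fun v _ => m v) (fun v _ => ?_) (fun v _ _ => h.ne v)
    (fun v _ => Finset.mem_univ _) (fun v _ => h.invol v)
  rw [h.invol, Sym2.eq_swap]
  exact CharTwo.add_self_eq_zero _

theorem mateWeight_neg (w : Sym2 V → ℤ) (m : V → V) :
    mateWeight (fun e => -w e) m = -mateWeight w m := by
  simp [mateWeight]

/-- Exchange the partners: pair `a` with `b`, and `m a` with `m b`. -/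
def flipMate (m : V → V) (a b : V) : V → V := fun x =>
  if x = a then b else if x = b then a else if x = m a then m b else if x = m b then m a else m x

theorem flipMate_of_ne {a b x : V} (h1 : x ≠ a) (h2 : x ≠ b) (h3 : x ≠ m a) (h4 : x ≠ m b) :
    flipMate m a b x = m x := by simp [flipMate, *]

theorem IsMateMap.flipMate (h : IsMateMap G m) {a b : V} (hab : G.Adj a b)
    (hab' : G.Adj (m a) (m b)) (hne : b ≠ m a) : IsMateMap G (flipMate m a b) := by
  have h1 := h.ne a
  have h2 := h.ne b
  have h3 := hab.ne
  have h4 := hab'.ne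
  have h5 : a ≠ m b := fun e => hne (by rw [e, h.invol])
  intro x
  by_cases x1 : x = a
  · subst x1
    simp [_root_.flipMate, h3.symm, hab]
  by_cases x2 : x = b
  · subst x2
    simp [_root_.flipMate, h3.symm, hab.symm]
  by_cases x3 : x = m a
  · subst x3
    simp [_root_.flipMate, h1, h2, hne.symm, h4.symm, h5.symm, hab']
  by_cases x4 : x = m b
  · subst x4
    simp [_root_.flipMate, h1, h2, h4.symm, hne.symm, h5.symm, hab'.symm]
  rw [flipMate_of_ne x1 x2 x3 x4, flipMate_of_ne, h.invol]
  · exact ⟨rfl, h.adj x⟩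
  · exact fun e => x3 (by rw [← e, h.invol])
  · exact fun e => x4 (by rw [← e, h.invol])
  · exact fun e => x1 (h.injective e)
  · exact fun e => x2 (h.injective e)

/-- The change of weight when `flipMate m a b` replaces `m`. -/
def flipGain (w : Sym2 V → ℤ) (m : V → V) (a b : V) : ℤ :=
  w s(a, b) + w s(m a, m b) - w s(a, m a) - w s(b, m b)

theorem IsMateMap.mateWeight_flipMate (h : IsMateMap G m) {a b : V} (hab : a ≠ b)
    (hne : b ≠ m a) (w : Sym2 V → ℤ) :
    mateWeight w (_root_.flipMate m a b) = mateWeight w m + 2 * flipGain w m a b := by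
  have h1 := h.ne a
  have h2 := h.ne b
  have h4 : m a ≠ m b := fun e => hab (h.injective e)
  have h5 : a ≠ m b := fun e => hne (by rw [e, h.invol])
  rw [← sub_eq_iff_eq_add', mateWeight, mateWeight, ← Finset.sum_sub_distrib,
    ← Finset.sum_subset (Finset.subset_univ {a, b, m a, m b})]
  · rw [Finset.sum_insert (by simp [hab, h1.symm, h5]),
      Finset.sum_insert (by simp [hne, h2.symm]), Finset.sum_insert (by simpa using h4),
      Finset.sum_singleton]
    simp only [_root_.flipMate, if_true, hab.symm, h1, h2, h4.symm, hne.symm, h5.symm, if_false,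
      h.invol, flipGain]
    rw [Sym2.eq_swap (a := b) (b := a), Sym2.eq_swap (a := m b) (b := m a),
      Sym2.eq_swap (a := m b) (b := b), Sym2.eq_swap (a := m a) (b := a)]
    ring
  · intro x _ hx
    simp only [Finset.mem_insert, Finset.mem_singleton, not_or] at hx
    rw [flipMate_of_ne hx.1 hx.2.1 hx.2.2.1 hx.2.2.2, sub_self]

theorem flipGain_bounds (hw : ∀ e f, w e ≤ w f + 1) (a b : V) :
    -2 ≤ flipGain w m a b ∧ flipGain w m a b ≤ 2 := by
  rw [flipGain]
  have := hw s(a, b) s(a, m a)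
  have := hw s(m a, m b) s(b, m b)
  have := hw s(a, m a) s(a, b)
  have := hw s(b, m b) s(m a, m b)
  constructor <;> linarith

/-- Follow `f` on `S` and `g` elsewhere. -/
theorem isMateMap_ite {f g : V → V} (S : Finset V)
    (hf : ∀ x ∈ S, f x ∈ S ∧ f (f x) = x ∧ G.Adj x (f x))
    (hg : ∀ x ∉ S, g x ∉ S ∧ g (g x) = x ∧ G.Adj x (g x)) :
    IsMateMap G (fun x => if x ∈ S then f x else g x) := by
  intro x
  by_cases hx : x ∈ S
  · simp [hx, hf x hx]
  · simp [hx, hg x hx]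

/-- Two matchings whose weights enclose `K`, all weights congruent modulo `4`. -/
structure Straddle (G : SimpleGraph V) (w : Sym2 V → ℤ) (K : ℤ) (m m' : V → V) : Prop where
  left : IsMateMap G m
  right : IsMateMap G m'
  lo : mateWeight w m ≤ K
  hi : K ≤ mateWeight w m'
  dvd_left : (4 : ℤ) ∣ mateWeight w m - K
  dvd_right : (4 : ℤ) ∣ mateWeight w m' - K

/-- The vertices with different partners. -/
def diffSet (m m' : V → V) : Finset V := Finset.univ.filter fun v => m v ≠ m' v

/-- The symmetric difference of the two matchings has more than one component. -/
def Splits {V : Type*} (m m' : V → V) : Prop :=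
  ∃ S : Finset V, (∀ x ∈ S, m x ∈ S ∧ m' x ∈ S) ∧ (∃ x ∈ S, m x ≠ m' x) ∧ ∃ x ∉ S, m x ≠ m' x

open Classical in
/-- The quantity minimised: size of the difference, connectedness, gap between the weights. -/
noncomputable def gapMeasure (w : Sym2 V → ℤ) (m m' : V → V) : ℕ ×ₗ ℕ ×ₗ ℕ :=
  toLex ((diffSet m m').card,
    toLex (if Splits m m' then 0 else 1, (mateWeight w m' - mateWeight w m).toNat))

/-- A minimal pair of matchings witnessing that the weight `K` is skipped. -/
structure MinimalGap (G : SimpleGraph V) (w : Sym2 V → ℤ) (K : ℤ) (m m' : V → V) : Prop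
    extends Straddle G w K m m' where
  unit : ∀ e f, w e ≤ w f + 1
  skip : ∀ N, IsMateMap G N → mateWeight w N ≠ K
  minimal : ∀ a b, Straddle G w K a b → ¬ gapMeasure w a b < gapMeasure w m m'

theorem diffSet_comm (m m' : V → V) : diffSet m m' = diffSet m' m := by
  simp [diffSet, ne_comm]

theorem splits_comm : Splits m m' ↔ Splits m' m := by
  simp only [Splits, ne_comm, and_comm]

theorem Straddle.swap (h : Straddle G w K m m') : Straddle G (fun e => -w e) (-K) m' m where
  left := h.right
  right := h.left
  lo := by rw [mateWeight_neg]; linarith [h.hi]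
  hi := by rw [mateWeight_neg]; linarith [h.lo]
  dvd_left := by have := h.dvd_right; rw [mateWeight_neg]; omega
  dvd_right := by have := h.dvd_left; rw [mateWeight_neg]; omega

theorem gapMeasure_swap : gapMeasure (fun e => -w e) m' m = gapMeasure w m m' := by
  have hs : Splits m' m ↔ Splits m m' := splits_comm
  simp only [gapMeasure, mateWeight_neg, diffSet_comm m' m, neg_sub_neg]
  by_cases h : Splits m m' <;> simp [hs, h]

theorem MinimalGap.swap (h : MinimalGap G w K m m') :
    MinimalGap G (fun e => -w e) (-K) m' m where
  toStraddle := h.toStraddle.swap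
  unit e f := by linarith [h.unit f e]
  skip N hN := by
    rw [mateWeight_neg]
    exact fun e => h.skip N hN (neg_injective e)
  minimal a b hab := by
    have := hab.swap
    simp only [neg_neg] at this
    rw [gapMeasure_swap, ← gapMeasure_swap (w := fun e => -w e)]
    simpa using h.minimal b a this

theorem MinimalGap.lo_add_four_le (h : MinimalGap G w K m m') : mateWeight w m + 4 ≤ K := by
  have := h.lo
  have := h.dvd_left
  have := h.skip m h.left
  omega

theorem MinimalGap.add_four_le_hi (h : MinimalGap G w K m m') : K + 4 ≤ mateWeight w m' := by
  have := h.hi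
  have := h.dvd_right
  have := h.skip m' h.right
  omega

theorem mem_diffSet {x : V} : x ∈ diffSet m m' ↔ m x ≠ m' x := by simp [diffSet]

theorem MinimalGap.diffSet_card_le (h : MinimalGap G w K m m') {a b : V → V}
    (hab : Straddle G w K a b) : (diffSet m m').card ≤ (diffSet a b).card := by
  by_contra! hlt
  exact h.minimal a b hab (Prod.Lex.toLex_lt_toLex.2 (Or.inl hlt))

/-- An intermediate matching sharing with each of `m`, `m'` an edge on which they differ is of the
wrong parity. -/
theorem MinimalGap.not_dvd (h : MinimalGap G w K m m') (hN : IsMateMap G N)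
    (hagree : ∀ v, m v = m' v → N v = m v) {x y : V} (hx : m x ≠ m' x) (hNx : N x = m x)
    (hy : m y ≠ m' y) (hNy : N y = m' y) : ¬ (4 : ℤ) ∣ mateWeight w N - K := by
  intro hdvd
  rcases le_total (mateWeight w N) K with hle | hle
  · refine (h.diffSet_card_le ⟨hN, h.right, hle, h.hi, hdvd, h.dvd_right⟩).not_gt
      (Finset.card_lt_card ?_)
    refine (Finset.ssubset_iff_of_subset fun v => ?_).2 ⟨y, by simpa [mem_diffSet], ?_⟩
    · rw [mem_diffSet, mem_diffSet]
      exact fun hv e => hv ((hagree v e).trans e)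
    · simp [mem_diffSet, hNy]
  · refine (h.diffSet_card_le ⟨h.left, hN, h.lo, hle, h.dvd_left, hdvd⟩).not_gt
      (Finset.card_lt_card ?_)
    refine (Finset.ssubset_iff_of_subset fun v => ?_).2 ⟨x, by simpa [mem_diffSet], ?_⟩
    · rw [mem_diffSet, mem_diffSet]
      exact fun hv e => hv (hagree v e).symm
    · simp [mem_diffSet, hNx]

theorem MinimalGap.mateWeight_ne_add_four (h : MinimalGap G w K m m') (hN : IsMateMap G N)
    (hagree : ∀ v, m v = m' v → N v = m v)
    (hsplit : Splits m m' → diffSet N m' = diffSet m m' → Splits N m') :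
    mateWeight w N ≠ mateWeight w m + 4 := by
  intro he
  have hlo := h.lo_add_four_le
  have hhi := h.hi
  have hS : Straddle G w K N m' :=
    ⟨hN, h.right, by omega, h.hi, by have := h.dvd_left; omega, h.dvd_right⟩
  have hsub : diffSet N m' ⊆ diffSet m m' := fun v => by
    rw [mem_diffSet, mem_diffSet]
    exact fun hv e => hv ((hagree v e).trans e)
  have heq := Finset.eq_of_subset_of_card_le hsub (h.diffSet_card_le hS)
  refine h.minimal N m' hS (Prod.Lex.toLex_lt_toLex.2 (Or.inr ⟨by rw [heq], ?_⟩))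
  refine Prod.Lex.toLex_lt_toLex.2 ?_
  simp only
  have hlt : (mateWeight w m' - mateWeight w N).toNat < (mateWeight w m' - mateWeight w m).toNat :=
    by omega
  by_cases h1 : Splits m m'
  · simp [h1, hsplit h1 heq, hlt]
  · by_cases h2 : Splits N m' <;> simp [h1, h2, hlt]

theorem MinimalGap.lt_of_splits (h : MinimalGap G w K m m') (hN : IsMateMap G N)
    (hagree : ∀ v, m v = m' v → N v = m v) (hns : ¬ Splits m m')
    (hsplit : diffSet m N = diffSet m m' → Splits m N)
    (hdvd : (4 : ℤ) ∣ mateWeight w N - K) : mateWeight w N < K := by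
  by_contra! hle
  have hS : Straddle G w K m N := ⟨h.left, hN, h.lo, hle, h.dvd_left, hdvd⟩
  have hsub : diffSet m N ⊆ diffSet m m' := fun v => by
    rw [mem_diffSet, mem_diffSet]
    exact fun hv e => hv (hagree v e).symm
  have heq := Finset.eq_of_subset_of_card_le hsub (h.diffSet_card_le hS)
  refine h.minimal m N hS (Prod.Lex.toLex_lt_toLex.2 (Or.inr ⟨by rw [heq], ?_⟩))
  refine Prod.Lex.toLex_lt_toLex.2 ?_
  simp [hns, hsplit heq]

/-- The gain of weight on `S` when `m'` replaces `m` there. -/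
def gapOn {V : Type*} (w : Sym2 V → ℤ) (m m' : V → V) (S : Finset V) : ℤ :=
  ∑ v ∈ S, (w s(v, m' v) - w s(v, m v))

theorem mateWeight_ite (w : Sym2 V → ℤ) (f g : V → V) (S : Finset V) :
    mateWeight w (fun x => if x ∈ S then f x else g x) = mateWeight w g + gapOn w g f S := by
  rw [← sub_eq_iff_eq_add', mateWeight, mateWeight, ← Finset.sum_sub_distrib, gapOn,
    ← Finset.sum_subset (Finset.subset_univ S)]
  · exact Finset.sum_congr rfl fun x hx => by simp [hx]
  · intro x _ hx
    simp [hx]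

theorem gapOn_add_compl (w : Sym2 V → ℤ) (m m' : V → V) (S : Finset V) :
    gapOn w m m' S + gapOn w m m' Sᶜ = mateWeight w m' - mateWeight w m := by
  rw [gapOn, gapOn, Finset.sum_add_sum_compl, Finset.sum_sub_distrib, mateWeight, mateWeight]

theorem IsMateMap.ite (hm : IsMateMap G m) (hm' : IsMateMap G m') {S : Finset V}
    (hS : ∀ x ∈ S, m x ∈ S ∧ m' x ∈ S) :
    IsMateMap G (fun x => if x ∈ S then m' x else m x) := by
  refine isMateMap_ite S (fun x hx => ⟨(hS x hx).2, hm' x⟩) fun x hx => ⟨fun h => hx ?_, hm x⟩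
  rw [← hm.invol x]
  exact (hS _ h).1

theorem two_dvd_gapOn (hm : IsMateMap G m) (hm' : IsMateMap G m') {S : Finset V}
    (hS : ∀ x ∈ S, m x ∈ S ∧ m' x ∈ S) (w : Sym2 V → ℤ) : 2 ∣ gapOn w m m' S := by
  have h1 := (hm.ite hm' hS).even_mateWeight w
  rw [mateWeight_ite] at h1
  exact (Int.dvd_iff_dvd_of_dvd_add h1).1 (hm.even_mateWeight w)

theorem gapOn_le_card (hw : ∀ e f, w e ≤ w f + 1) (S : Finset V) : gapOn w m m' S ≤ S.card := by
  calc gapOn w m m' S ≤ ∑ _v ∈ S, 1 := Finset.sum_le_sum fun v _ => by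
        linarith [hw s(v, m' v) s(v, m v)]
    _ = S.card := by simp

theorem closed_compl (hm : IsMateMap G m) (hm' : IsMateMap G m') {S : Finset V}
    (hS : ∀ x ∈ S, m x ∈ S ∧ m' x ∈ S) : ∀ x ∈ Sᶜ, m x ∈ Sᶜ ∧ m' x ∈ Sᶜ := by
  intro x hx
  rw [Finset.mem_compl] at hx
  constructor
  · rw [Finset.mem_compl]
    intro h
    have := (hS _ h).1
    rw [hm.invol] at this
    exact hx this
  · rw [Finset.mem_compl]
    intro h
    have := (hS _ h).2
    rw [hm'.invol] at this
    exact hx this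

theorem MinimalGap.not_dvd_gapOn (h : MinimalGap G w K m m') {S : Finset V}
    (hS : ∀ x ∈ S, m x ∈ S ∧ m' x ∈ S) {x y : V} (hx : x ∈ S) (hxd : m x ≠ m' x) (hy : y ∉ S)
    (hyd : m y ≠ m' y) : ¬ (4 : ℤ) ∣ gapOn w m m' S := by
  intro hdvd
  refine h.not_dvd (h.left.ite h.right hS) (fun v hv => ?_) hyd (by simp [hy]) hxd (by simp [hx]) ?_
  · simp [hv]
  · rw [mateWeight_ite]
    have := h.dvd_left
    omega

theorem altSeq_mem (v : V) {S : Finset V} (hS : ∀ x ∈ S, m x ∈ S ∧ m' x ∈ S) (hv : v ∈ S)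
    (i : ℕ) : altSeq m m' v i ∈ S := by
  induction i with
  | zero => exact hv
  | succ i ih =>
    simp only [altSeq]
    split_ifs
    exacts [(hS _ ih).1, (hS _ ih).2]

theorem closed_diffSet (hm : IsMateMap G m) (hm' : IsMateMap G m') :
    ∀ x ∈ diffSet m m', m x ∈ diffSet m m' ∧ m' x ∈ diffSet m m' := by
  intro x hx
  simp only [mem_diffSet] at hx ⊢
  constructor
  · rw [hm.invol]
    intro e
    exact hx (by rw [← hm'.invol (m x), ← e])
  · rw [hm'.invol]
    intro e
    exact hx (by rw [← hm.invol (m' x), e])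

theorem altSeq_diff (hm : IsMateMap G m) (hm' : IsMateMap G m') {v : V} (hv : m v ≠ m' v)
    (i : ℕ) : m (altSeq m m' v i) ≠ m' (altSeq m m' v i) :=
  mem_diffSet.1 (altSeq_mem v (closed_diffSet hm hm') (mem_diffSet.2 hv) i)

theorem IsAltPeriod.shift {v : V} {n : ℕ} (h : IsAltPeriod m m' v n) (a : ℕ) :
    if Even a then IsAltPeriod m m' (altSeq m m' v a) n
      else IsAltPeriod m' m (altSeq m m' v a) n := by
  have key : ∀ i j, i < n → j < n → altSeq m m' v (a + i) = altSeq m m' v (a + j) → i = j := by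
    intro i j hi hj hij
    rw [← h.mod_eq, ← h.mod_eq (a + j)] at hij
    have := h.inj _ _ (Nat.mod_lt _ h.pos) (Nat.mod_lt _ h.pos) hij
    exact Nat.ModEq.eq_of_lt_of_lt (Nat.ModEq.add_left_cancel' a this) hi hj
  have hadd := altSeq_add (m := m) (m' := m') v a
  split_ifs with ha <;> simp only [ha, if_true, if_false] at hadd <;>
    refine ⟨h.pos, h.even, fun i => ?_, fun i j hi hj hij => key i j hi hj ?_⟩
  · rw [← hadd, ← hadd, ← add_assoc, h.add_period]
  · rw [hadd, hadd, hij]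
  · rw [← hadd, ← hadd, ← add_assoc, h.add_period]
  · rw [hadd, hadd, hij]

theorem left_altSeq_odd (hm : IsMateMap G m) (v : V) {i : ℕ} (hi : Even i) :
    m (altSeq m m' v (i + 1)) = altSeq m m' v i := by
  rw [altSeq_succ_of_even v hi, hm.invol]

theorem right_altSeq_even (hm' : IsMateMap G m') (v : V) {i : ℕ} (hi : Odd i) :
    m' (altSeq m m' v (i + 1)) = altSeq m m' v i := by
  rw [altSeq_succ_of_odd v hi, hm'.invol]

/-- Use the chord from `v` to the `d`-th vertex of the alternating sequence, follow `m'` strictly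
between its ends, and `m` elsewhere. -/
def chordMate (m m' : V → V) (v : V) (d : ℕ) : V → V := fun x =>
  if x = v then altSeq m m' v d else if x = altSeq m m' v d then v
  else if x ∈ (Finset.Ico 1 d).image (altSeq m m' v) then m' x else m x

theorem IsAltPeriod.chordMate_altSeq {v : V} {n d : ℕ} (h : IsAltPeriod m m' v n) (hd : d < n)
    {j : ℕ} (hj : j < n) :
    chordMate m m' v d (altSeq m m' v j) = if j = 0 then altSeq m m' v d else if j = d then v
      else if j < d then m' (altSeq m m' v j) else m (altSeq m m' v j) := by
  have h0 : altSeq m m' v j = v ↔ j = 0 :=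
    ⟨fun e => h.inj j 0 hj h.pos e, fun e => by rw [e]; rfl⟩
  have h1 : altSeq m m' v j = altSeq m m' v d ↔ j = d :=
    ⟨fun e => h.inj j d hj hd e, fun e => by rw [e]⟩
  have h2 : altSeq m m' v j ∈ (Finset.Ico 1 d).image (altSeq m m' v) ↔ 1 ≤ j ∧ j < d := by
    rw [Finset.mem_image]
    constructor
    · rintro ⟨i, hi, e⟩
      rw [Finset.mem_Ico] at hi
      rw [← h.inj i j (by omega) hj e]
      exact hi
    · exact fun hj => ⟨j, Finset.mem_Ico.2 hj, rfl⟩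
  simp only [chordMate, h0, h1, h2]
  split_ifs <;> first | rfl | omega

theorem chordMate_of_forall_ne {v : V} {d : ℕ} {x : V} (hx : ∀ i, x ≠ altSeq m m' v i) :
    chordMate m m' v d x = m x := by
  have h2 : x ∉ (Finset.Ico 1 d).image (altSeq m m' v) := by
    rw [Finset.mem_image]
    rintro ⟨i, -, e⟩
    exact hx i e.symm
  simp only [chordMate, show x ≠ v from hx 0, hx d, h2, if_false]

theorem IsAltPeriod.isMateMap_chordMate {v : V} {n d : ℕ} (h : IsAltPeriod m m' v n)
    (hm : IsMateMap G m) (hm' : IsMateMap G m') (hd : Odd d) (hdn : d < n)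
    (hadj : G.Adj v (altSeq m m' v d)) : IsMateMap G (chordMate m m' v d) := by
  have hd0 : d ≠ 0 := by rintro rfl; simp at hd
  intro x
  by_cases hx : ∃ i, x = altSeq m m' v i
  · obtain ⟨i, rfl⟩ := hx
    rw [← h.mod_eq]
    have hj : i % n < n := Nat.mod_lt _ h.pos
    generalize i % n = j at hj
    rw [h.chordMate_altSeq hdn hj]
    split_ifs with j0 jd jlt
    · subst j0
      refine ⟨?_, hadj⟩
      rw [h.chordMate_altSeq hdn hdn, if_neg hd0, if_pos rfl]
      rfl
    · subst jd
      refine ⟨?_, hadj.symm⟩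
      have := h.chordMate_altSeq hdn h.pos
      rw [if_pos rfl] at this
      exact this
    · refine ⟨?_, hm'.adj _⟩
      rcases Nat.even_or_odd j with hev | hodd
      · obtain ⟨l, rfl⟩ : ∃ l, j = l + 1 := ⟨j - 1, by omega⟩
        have hl : Odd l := by simpa [Nat.even_add_one] using hev
        have hl0 : l ≠ 0 := by rintro rfl; simp at hl
        rw [right_altSeq_even hm' v hl, h.chordMate_altSeq hdn (by omega), if_neg hl0,
          if_neg (by omega), if_pos (by omega), altSeq_succ_of_odd v hl]
      · have hne : j + 1 ≠ d := by
          rintro rfl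
          simp [Nat.odd_add_one, hodd] at hd
        rw [← altSeq_succ_of_odd (m := m) (m' := m') v hodd,
          h.chordMate_altSeq hdn (by omega), if_neg (by omega), if_neg hne,
          if_pos (by omega), right_altSeq_even hm' v hodd]
    · refine ⟨?_, hm.adj _⟩
      rcases Nat.even_or_odd j with hev | hodd
      · have hjn : j + 1 ≠ n := by
          rintro rfl
          have := h.even
          simp [Nat.even_add_one, hev] at this
        rw [← altSeq_succ_of_even (m := m) (m' := m') v hev,
          h.chordMate_altSeq hdn (by omega), if_neg (by omega), if_neg (by omega),
          if_neg (by omega), left_altSeq_odd hm v hev]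
      · obtain ⟨l, rfl⟩ : ∃ l, j = l + 1 := ⟨j - 1, by omega⟩
        have hl : Even l := by simpa [Nat.odd_add_one] using hodd
        have hld : l ≠ d := by
          rintro rfl
          exact Nat.not_even_iff_odd.2 hd hl
        have hl0 : l ≠ 0 := by omega
        rw [left_altSeq_odd hm v hl, h.chordMate_altSeq hdn (by omega), if_neg hl0, if_neg hld,
          if_neg (by omega), altSeq_succ_of_even v hl]
  · push Not at hx
    rw [chordMate_of_forall_ne hx]
    refine ⟨?_, hm.adj x⟩
    rw [chordMate_of_forall_ne, hm.invol]
    intro i e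
    rcases Nat.even_or_odd i with hev | hodd
    · exact hx (i + 1) (by rw [altSeq_succ_of_even v hev, ← e, hm.invol])
    · obtain ⟨l, rfl⟩ : ∃ l, i = l + 1 := ⟨i - 1, by have := hodd.pos; omega⟩
      have hl : Even l := by simpa [Nat.odd_add_one] using hodd
      exact hx l (by rw [← left_altSeq_odd hm v hl, ← e, hm.invol])

theorem chordMate_of_eq (hm : IsMateMap G m) (hm' : IsMateMap G m') {v x : V} (hv : m v ≠ m' v)
    (hx : m x = m' x) (d : ℕ) : chordMate m m' v d x = m x := by
  refine chordMate_of_forall_ne fun i e => ?_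
  subst e
  exact altSeq_diff hm hm' hv i hx

theorem MinimalGap.not_dvd_chordMate (h : MinimalGap G w K m m') {v : V} {n d : ℕ}
    (hv : m v ≠ m' v) (hper : IsAltPeriod m m' v n) (hd : Odd d) (hd3 : 3 ≤ d) (hdn : d + 3 ≤ n)
    (hadj : G.Adj v (altSeq m m' v d)) :
    ¬ (4 : ℤ) ∣ mateWeight w (chordMate m m' v d) - K := by
  refine h.not_dvd (hper.isMateMap_chordMate h.left h.right hd (by omega) hadj)
    (fun x hx => chordMate_of_eq h.left h.right hv hx d)
    (altSeq_diff h.left h.right hv (d + 1)) ?_ (altSeq_diff h.left h.right hv 1) ?_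
  · rw [hper.chordMate_altSeq (by omega) (by omega), if_neg (by omega), if_neg (by omega),
      if_neg (by omega)]
  · rw [hper.chordMate_altSeq (by omega) (by omega), if_neg (by omega), if_neg (by omega),
      if_pos (by omega)]

/-- If the difference has a vertex outside a component, that component has no odd chord. -/
theorem MinimalGap.not_adj_of_odd (h : MinimalGap G w K m m') {S : Finset V}
    (hS : ∀ x ∈ S, m x ∈ S ∧ m' x ∈ S) {v y : V} {n d : ℕ} (hvS : v ∈ S)
    (hv : m v ≠ m' v) (hyS : y ∉ S) (hy : m y ≠ m' y) (hper : IsAltPeriod m m' v n) (hd : Odd d)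
    (hd3 : 3 ≤ d) (hdn : d + 3 ≤ n) : ¬ G.Adj v (altSeq m m' v d) := by
  intro hadj
  have hN := hper.isMateMap_chordMate h.left h.right hd (by omega) hadj
  have hnd := h.not_dvd_chordMate hv hper hd hd3 hdn hadj
  have hmem := fun i => altSeq_mem (m := m) (m' := m') v hS hvS i
  have hoff : ∀ x ∉ S, chordMate m m' v d x = m x := fun x hx =>
    chordMate_of_forall_ne fun i e => hx (e ▸ hmem i)
  have hScl : ∀ x ∈ Sᶜ, chordMate m m' v d x ∈ Sᶜ ∧ m' x ∈ Sᶜ := by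
    intro x hx
    rw [hoff x (Finset.mem_compl.1 hx)]
    exact closed_compl h.left h.right hS x hx
  have hN' := hN.ite h.right hScl
  have hw := mateWeight_ite w m' (chordMate m m' v d) Sᶜ
  have hg : gapOn w (chordMate m m' v d) m' Sᶜ = gapOn w m m' Sᶜ :=
    Finset.sum_congr rfl fun x hx => by rw [hoff x (Finset.mem_compl.1 hx)]
  have h1 := h.not_dvd_gapOn (closed_compl h.left h.right hS) (Finset.mem_compl.2 hyS) hy
    (by simpa using hvS) hv
  have h2 := two_dvd_gapOn h.left h.right (closed_compl h.left h.right hS) w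
  have h3 := hN.even_mateWeight w
  have h4 := h.left.even_mateWeight w
  have h5 := h.dvd_left
  refine h.not_dvd hN' (fun x hx => ?_) (altSeq_diff h.left h.right hv (d + 1)) ?_
    (altSeq_diff h.left h.right hv 1) ?_ ?_
  · simp only [chordMate_of_eq h.left h.right hv hx d, ← hx, ite_self]
  · simp only [Finset.mem_compl, hmem, not_true, if_false]
    rw [hper.chordMate_altSeq (by omega) (by omega), if_neg (by omega), if_neg (by omega),
      if_neg (by omega)]
  · simp only [Finset.mem_compl, hmem, not_true, if_false]
    rw [hper.chordMate_altSeq (by omega) (by omega), if_neg (by omega), if_neg (by omega),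
      if_pos (by omega)]
  · rw [hw, hg]
    omega

theorem sum_comp_of_injective {S : Finset V} {g : V → V} (hg : Function.Injective g)
    (hS : ∀ x ∈ S, g x ∈ S) (F : V → ℤ) : ∑ x ∈ S, F (g x) = ∑ x ∈ S, F x := by
  have himg : S.image g = S := by
    refine Finset.eq_of_subset_of_card_le (fun y hy => ?_)
      (Finset.card_image_of_injective S hg).ge
    obtain ⟨x, hx, rfl⟩ := Finset.mem_image.1 hy
    exact hS x hx
  rw [← Finset.sum_image (f := F) (g := g) hg.injOn, himg]

/-- `τ` moves along the alternating cycles of `m` and `m'`, with inverse `τ'`. -/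
structure IsRotation {V : Type*} (m m' τ τ' : V → V) : Prop where
  left_inv : ∀ x, τ' (τ x) = x
  right_inv : ∀ x, τ (τ' x) = x
  left_comm : ∀ x, m (τ x) = τ' (m x)
  right_comm : ∀ x, m' (τ' x) = τ (m' x)
  closed : ∀ S : Finset V, (∀ x ∈ S, m x ∈ S ∧ m' x ∈ S) → ∀ x ∈ S, τ x ∈ S ∧ τ' x ∈ S

theorem IsRotation.swap {τ τ' : V → V} (h : IsRotation m m' τ τ') : IsRotation m' m τ' τ where
  left_inv := h.right_inv
  right_inv := h.left_inv
  left_comm := h.right_comm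
  right_comm := h.left_comm
  closed S hS x hx := (h.closed S (fun x hx => (hS x hx).symm) x hx).symm

theorem isRotation_one (hm : IsMateMap G m) (hm' : IsMateMap G m') :
    IsRotation m m' (fun x => m' (m x)) (fun x => m (m' x)) where
  left_inv x := by simp only [hm.invol, hm'.invol]
  right_inv x := by simp only [hm.invol, hm'.invol]
  left_comm x := rfl
  right_comm x := rfl
  closed S hS x hx := ⟨(hS _ (hS _ hx).1).2, (hS _ (hS _ hx).2).1⟩

theorem isRotation_two (hm : IsMateMap G m) (hm' : IsMateMap G m') :
    IsRotation m m' (fun x => m' (m (m' (m x)))) (fun x => m (m' (m (m' x)))) where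
  left_inv x := by simp only [hm.invol, hm'.invol]
  right_inv x := by simp only [hm.invol, hm'.invol]
  left_comm x := rfl
  right_comm x := rfl
  closed S hS x hx :=
    ⟨(hS _ (hS _ (hS _ (hS _ hx).1).2).1).2, (hS _ (hS _ (hS _ (hS _ hx).2).1).2).1⟩

theorem IsRotation.sum_flipGain {τ τ' : V → V} (h : IsRotation m m' τ τ') (hm : IsMateMap G m)
    {S : Finset V} (hS : ∀ x ∈ S, m x ∈ S ∧ m' x ∈ S) (w : Sym2 V → ℤ) :
    ∑ x ∈ S, flipGain w m x (τ x) = 2 * ∑ x ∈ S, w s(x, τ x) - 2 * ∑ x ∈ S, w s(x, m x) := by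
  have hτ : Function.Injective τ := Function.LeftInverse.injective h.left_inv
  have h1 : ∑ x ∈ S, w s(m x, m (τ x)) = ∑ x ∈ S, w s(x, τ x) := by
    rw [← sum_comp_of_injective (g := fun x => m (τ x)) (hm.injective.comp hτ)
      (fun x hx => (hS _ (h.closed S hS x hx).1).1) (fun x => w s(x, τ x))]
    refine Finset.sum_congr rfl fun x _ => ?_
    simp only [h.left_comm, h.right_inv]
    rw [Sym2.eq_swap]
  have h2 : ∑ x ∈ S, w s(τ x, m (τ x)) = ∑ x ∈ S, w s(x, m x) :=
    sum_comp_of_injective hτ (fun x hx => (h.closed S hS x hx).1) (fun x => w s(x, m x))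
  simp only [flipGain, Finset.sum_sub_distrib, Finset.sum_add_distrib, h1, h2]
  ring

theorem IsRotation.sum_flipGain_sub {τ τ' : V → V} (h : IsRotation m m' τ τ')
    (hm : IsMateMap G m) (hm' : IsMateMap G m') {S : Finset V}
    (hS : ∀ x ∈ S, m x ∈ S ∧ m' x ∈ S) (w : Sym2 V → ℤ) :
    ∑ x ∈ S, flipGain w m x (τ x) - ∑ x ∈ S, flipGain w m' x (τ' x) = 2 * gapOn w m m' S := by
  rw [h.sum_flipGain hm hS, h.swap.sum_flipGain hm' fun x hx => (hS x hx).symm]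
  have h1 : ∑ x ∈ S, w s(x, τ' x) = ∑ x ∈ S, w s(x, τ x) := by
    rw [← sum_comp_of_injective (Function.LeftInverse.injective h.left_inv)
      (fun x hx => (h.closed S hS x hx).1) (fun x => w s(x, τ' x))]
    refine Finset.sum_congr rfl fun x _ => ?_
    rw [h.left_inv, Sym2.eq_swap]
  rw [h1, gapOn, Finset.sum_sub_distrib]
  ring

theorem flipGain_neg (w : Sym2 V → ℤ) (m : V → V) (a b : V) :
    flipGain (fun e => -w e) m a b = -flipGain w m a b := by
  simp only [flipGain]
  ring

theorem flipMate_of_eq (hm : IsMateMap G m) (hm' : IsMateMap G m') {a b x : V} (ha : m a ≠ m' a)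
    (hb : m b ≠ m' b) (hx : m x = m' x) : flipMate m a b x = m x := by
  have hma := mem_diffSet.1 (closed_diffSet hm hm' a (mem_diffSet.2 ha)).1
  have hmb := mem_diffSet.1 (closed_diffSet hm hm' b (mem_diffSet.2 hb)).1
  apply flipMate_of_ne <;> rintro rfl <;> contradiction

theorem flipMate_mem {S : Finset V} {a b x : V} (hS : ∀ x ∈ S, m x ∈ S ∧ m' x ∈ S) (ha : a ∈ S)
    (hb : b ∈ S) (hx : x ∈ S) : flipMate m a b x ∈ S := by
  have := fun x hx => (hS x hx).1
  unfold flipMate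
  split_ifs <;> simp [*]

theorem MinimalGap.flipGain_nonpos_of_splits (h : MinimalGap G w K m m') {S : Finset V}
    (hS : ∀ x ∈ S, m x ∈ S ∧ m' x ∈ S) (hSd : ∀ x ∈ S, m x ≠ m' x) (hcard : 6 ≤ S.card) {y : V}
    (hyS : y ∉ S) (hy : m y ≠ m' y) {a b : V} (ha : a ∈ S) (hb : b ∈ S) (hab : G.Adj a b)
    (hab' : G.Adj (m a) (m b)) (hne : b ≠ m a) : flipGain w m a b ≤ 0 := by
  have hN := h.left.flipMate hab hab' hne
  have hNw := h.left.mateWeight_flipMate hab.ne hne w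
  have hag : ∀ v, m v = m' v → flipMate m a b v = m v := fun v hv =>
    flipMate_of_eq h.left h.right (hSd a ha) (hSd b hb) hv
  have hoff : ∀ x ∉ S, flipMate m a b x = m x := fun x hx =>
    flipMate_of_ne (fun e => hx (e ▸ ha)) (fun e => hx (e ▸ hb)) (fun e => hx (e ▸ (hS a ha).1))
      (fun e => hx (e ▸ (hS b hb).1))
  have hdl := h.dvd_left
  have heven : 2 ∣ flipGain w m a b := by
    by_contra hodd
    have hScl : ∀ x ∈ Sᶜ, flipMate m a b x ∈ Sᶜ ∧ m' x ∈ Sᶜ := by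
      intro x hx
      rw [hoff x (Finset.mem_compl.1 hx)]
      exact closed_compl h.left h.right hS x hx
    have hN' := hN.ite h.right hScl
    have hw := mateWeight_ite w m' (flipMate m a b) Sᶜ
    have hg : gapOn w (flipMate m a b) m' Sᶜ = gapOn w m m' Sᶜ :=
      Finset.sum_congr rfl fun x hx => by rw [hoff x (Finset.mem_compl.1 hx)]
    have h1 := h.not_dvd_gapOn (closed_compl h.left h.right hS) (Finset.mem_compl.2 hyS) hy
      (by simpa using ha) (hSd a ha)
    have h2 := two_dvd_gapOn h.left h.right (closed_compl h.left h.right hS) w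
    obtain ⟨x, hxS, hx⟩ := Finset.exists_mem_notMem_of_card_lt_card
      (s := {a, b, m a, m b}) (t := S) (Finset.card_le_four.trans_lt (by omega))
    simp only [Finset.mem_insert, Finset.mem_singleton, not_or] at hx
    refine h.not_dvd hN' (fun v hv => ?_) (x := x) (hSd x hxS) ?_ hy ?_ ?_
    · simp only [hag v hv, ← hv, ite_self]
    · simp only [Finset.mem_compl, hxS, not_true, if_false]
      exact flipMate_of_ne hx.1 hx.2.1 hx.2.2.1 hx.2.2.2
    · simp only [Finset.mem_compl, hyS, not_false_eq_true, if_true]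
    · rw [hw, hg]
      omega
  by_contra! hpos
  have h2 := (flipGain_bounds (m := m) h.unit a b).2
  refine h.mateWeight_ne_add_four hN hag (fun _ hdiff => ⟨S, fun x hx =>
    ⟨flipMate_mem hS ha hb hx, (hS x hx).2⟩, ⟨a, ha, ?_⟩, ⟨y, hyS, ?_⟩⟩) (by omega)
  · rw [← mem_diffSet, hdiff, mem_diffSet]
    exact hSd a ha
  · rwa [hoff y hyS]

theorem IsAltPeriod.exists_isCycle (hm : IsMateMap G m) (hm' : IsMateMap G m') {v : V}
    {n : ℕ} (hper : IsAltPeriod m m' v n) (hn : 3 ≤ n) :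
    ∃ C : G.Walk v v, C.IsCycle ∧ C.length = n ∧ (∀ i, cvtx C i = altSeq m m' v (i + 1)) ∧
      ∀ i, s(altSeq m m' v i, altSeq m m' v (i + 1)) ∈ C.edges :=
  exists_cycle_of_seq (altSeq m m' v) (fun i => by
    rcases Nat.even_or_odd i with hi | hi
    · rw [altSeq_succ_of_even v hi]
      exact hm.adj _
    · rw [altSeq_succ_of_odd v hi]
      exact hm'.adj _) n hn hper.add_period hper.inj

/-- Adjacency at all even distances `k` and `n - k` along a cycle of length `n` gives adjacency of
every vertex to its image under the rotation by `k`. -/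
theorem IsAltPeriod.adj_rotate {v : V} {n k : ℕ} (hper : IsAltPeriod m m' v n) (hk : 0 < k)
    (hkn : k < n)
    (hadj : ∀ i j, i < j → j < n → (j - i = k ∨ j - i = n - k) →
      G.Adj (altSeq m m' v (i + 1)) (altSeq m m' v (j + 1))) (a : ℕ) :
    G.Adj (altSeq m m' v a) (altSeq m m' v (a + k)) := by
  have hi : (a + n - 1) % n < n := Nat.mod_lt _ hper.pos
  have hcong : altSeq m m' v a = altSeq m m' v ((a + n - 1) % n + 1) := by
    rw [← hper.mod_eq ((a + n - 1) % n + 1), Nat.mod_add_mod,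
      show a + n - 1 + 1 = a + n by omega, Nat.add_mod_right, hper.mod_eq]
  have hcong' : altSeq m m' v (a + k) = altSeq m m' v ((a + n - 1) % n + k + 1) := by
    rw [← hper.mod_eq ((a + n - 1) % n + k + 1), add_assoc, Nat.mod_add_mod,
      show a + n - 1 + (k + 1) = a + k + n by omega, Nat.add_mod_right, hper.mod_eq]
  rw [hcong, hcong']
  generalize (a + n - 1) % n = i at hi
  by_cases hlt : i + k < n
  · exact hadj i (i + k) (by omega) hlt (Or.inl (by omega))
  · have := hadj (i + k - n) i (by omega) hi (Or.inr (by omega))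
    rw [show i + k + 1 = i + k - n + 1 + n by omega, hper.add_period]
    exact this.symm

theorem IsAltPeriod.adj_rotation {τ τ' : V → V} (hr : IsRotation m m' τ τ') {v : V} {n k : ℕ}
    (hper : IsAltPeriod m m' v n) (hkn : k < n) (hk : Even k)
    (hτ : ∀ u, altSeq m m' u k = τ u) (hτ' : ∀ u, altSeq m' m u k = τ' u)
    (hadj : ∀ a, G.Adj (altSeq m m' v a) (altSeq m m' v (a + k))) :
    ∀ x ∈ altSet m m' v n, G.Adj x (τ x) := by
  intro x hx
  obtain ⟨a, -, rfl⟩ := Finset.mem_image.1 hx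
  by_cases ha : Even a
  · have := hadj a
    rwa [altSeq_add, if_pos ha, hτ] at this
  · have hb : ¬ Even (a + (n - k)) := by
      rw [Nat.even_add, Nat.even_sub hkn.le]
      have := hper.even
      tauto
    have hbk : altSeq m m' v (a + (n - k) + k) = altSeq m m' v a := by
      rw [show a + (n - k) + k = a + n by omega, hper.add_period]
    have h1 := hadj (a + (n - k))
    rw [hbk] at h1
    rw [altSeq_add, if_neg hb, hτ'] at hbk
    rw [← hbk, hr.right_inv, hbk]
    exact h1.symm

theorem IsRotation.adj_left {τ τ' : V → V} (hr : IsRotation m m' τ τ') {S : Finset V}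
    (hS : ∀ x ∈ S, m x ∈ S ∧ m' x ∈ S) (hadj : ∀ x ∈ S, G.Adj x (τ x)) :
    ∀ x ∈ S, G.Adj (m x) (m (τ x)) := by
  intro x hx
  have := hadj (τ' (m x)) (hr.closed S hS _ (hS x hx).1).2
  rw [hr.right_inv] at this
  rw [hr.left_comm]
  exact this.symm

theorem IsRotation.adj_swap {τ τ' : V → V} (hr : IsRotation m m' τ τ') {S : Finset V}
    (hS : ∀ x ∈ S, m x ∈ S ∧ m' x ∈ S) (hadj : ∀ x ∈ S, G.Adj x (τ x)) :
    ∀ x ∈ S, G.Adj x (τ' x) := by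
  intro x hx
  have := hadj (τ' x) (hr.closed S hS x hx).2
  rw [hr.right_inv] at this
  exact this.symm

/-- A chord of the cycle is not an edge of it, so its two ends are at distance at least `3` if they
are at odd distance. -/
theorem three_le_of_chord {v : V} {n i j : ℕ} {E : List (Sym2 V)}
    (hper : IsAltPeriod m m' v n)
    (hE : ∀ i, s(altSeq m m' v i, altSeq m m' v (i + 1)) ∈ E)
    (hij : i < j) (hodd : Odd (j - i))
    (hch : s(altSeq m m' v i, altSeq m m' v j) ∉ E) (hjn : j < i + n) :
    3 ≤ j - i ∧ j - i + 3 ≤ n := by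
  have heven := hper.even
  have h1 : j - i ≠ 1 := by
    intro e
    exact hch (by rw [show j = i + 1 by omega]; exact hE i)
  have h2 : j + 1 ≠ i + n := by
    intro e
    apply hch
    have := hE j
    rwa [e, hper.add_period, Sym2.eq_swap] at this
  rw [Nat.odd_iff] at hodd
  rw [Nat.even_iff] at heven
  omega

theorem MinimalGap.gapOn_lt_five (h : MinimalGap G w K m m') (hG : ChordProperty G)
    {S : Finset V} (hS : ∀ x ∈ S, m x ∈ S ∧ m' x ∈ S) {x y : V} (hxS : x ∈ S) (hx : m x ≠ m' x)
    (hyS : y ∉ S) (hy : m y ≠ m' y) : gapOn w m m' S < 5 := by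
  by_contra! hgap
  obtain ⟨n, hper⟩ := exists_isAltPeriod h.left.invol_ne h.right.invol_ne x
  set C := altSet m m' x n with hC
  have hCcl : ∀ z ∈ C, m z ∈ C ∧ m' z ∈ C := fun z hz =>
    hper.apply_mem_altSet h.left.invol h.right.invol hz
  have hxC : x ∈ C := hper.mem_altSet 0
  have hCd : ∀ z ∈ C, m z ≠ m' z := by
    intro z hz
    obtain ⟨i, -, rfl⟩ := Finset.mem_image.1 hz
    exact altSeq_diff h.left h.right hx i
  have hCS : C ⊆ S := by
    intro z hz
    obtain ⟨i, -, rfl⟩ := Finset.mem_image.1 hz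
    exact altSeq_mem x hS hxS i
  have hyC : y ∉ C := fun hyC => hyS (hCS hyC)
  have hsplit : gapOn w m m' (S \ C) + gapOn w m m' C = gapOn w m m' S :=
    Finset.sum_sdiff hCS
  have hCgap : 5 ≤ gapOn w m m' C := by
    by_cases hz : ∃ z ∈ S \ C, m z ≠ m' z
    · obtain ⟨z, hz, hzd⟩ := hz
      have hdiff : ∀ z ∈ S \ C, m z ∈ S \ C ∧ m' z ∈ S \ C := by
        intro z hz
        rw [Finset.mem_sdiff] at hz
        have h1 := hS z hz.1
        have h2 := closed_compl h.left h.right hCcl z (Finset.mem_compl.2 hz.2)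
        simp only [Finset.mem_compl] at h2
        simp [h1, h2]
      have h1 := h.not_dvd_gapOn hdiff hz hzd (y := y) (by simp [hyS]) hy
      have h2 := h.not_dvd_gapOn hCcl hxC hx hyC hy
      have h3 := h.not_dvd_gapOn hS hxS hx hyS hy
      have h4 := two_dvd_gapOn h.left h.right hdiff w
      have h5 := two_dvd_gapOn h.left h.right hCcl w
      omega
    · push Not at hz
      have h0 : gapOn w m m' (S \ C) = 0 :=
        Finset.sum_eq_zero fun z hzm => by rw [hz z hzm, sub_self]
      omega
  have hCn : C.card = n := hper.card_altSet
  have hn : 6 ≤ n := by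
    have h1 := gapOn_le_card (m := m) (m' := m') h.unit C
    obtain ⟨l, hl⟩ := hper.even
    omega
  obtain ⟨W, hW, hlen, hvtx, hedge⟩ := hper.exists_isCycle h.left h.right (by omega)
  have hadj : ∀ z ∈ C, G.Adj z (m' (m z)) := by
    rcases hG.1 x W hW (hlen ▸ hper.even) (hlen ▸ hn) with ⟨i, j, hij, hj, hodd, hadj, hch⟩ | hall
    · exfalso
      rw [hlen] at hj
      rw [hvtx, hvtx] at hadj hch
      have hodd' : Odd (j + 1 - (i + 1)) := by rwa [Nat.add_sub_add_right]
      obtain ⟨h3, h4⟩ := three_le_of_chord hper hedge (by omega) hodd' hch (by omega)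
      have hsh := hper.shift (i + 1)
      have hadd := altSeq_add (m := m) (m' := m') x (i + 1) (j + 1 - (i + 1))
      rw [show i + 1 + (j + 1 - (i + 1)) = j + 1 by omega] at hadd
      rw [hadd] at hadj
      have hmem := altSeq_mem x hCcl hxC (i + 1)
      have hmemd := hCd _ hmem
      split_ifs at hsh hadj
      · exact h.not_adj_of_odd hCcl hmem hmemd hyC hy hsh hodd' h3 h4 hadj
      · exact h.swap.not_adj_of_odd (fun z hz => (hCcl z hz).symm) hmem hmemd.symm hyC hy.symm hsh
          hodd' h3 h4 hadj
    · refine hper.adj_rotation (k := 2) (isRotation_one h.left h.right) (by omega) (by decide)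
        (fun u => ?_) (fun u => ?_)
        (hper.adj_rotate (by omega) (by omega) fun i j hij hj hd => ?_)
      · simp [altSeq]
      · simp [altSeq]
      · have := hall i j hij (by omega) (by
          rcases hd with hd | hd
          · simp [hd]
          · rw [hd, Nat.even_sub (by omega)]
            simp [hper.even])
        rwa [hvtx, hvtx] at this
  have hr := isRotation_one h.left h.right
  have h1 : ∑ z ∈ C, flipGain w m z (m' (m z)) ≤ 0 := Finset.sum_nonpos fun z hz =>
    h.flipGain_nonpos_of_splits hCcl hCd (by omega) hyC hy hz (hr.closed C hCcl z hz).1 (hadj z hz)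
      (hr.adj_left hCcl hadj z hz) (h.right.ne _)
  have hCcl' : ∀ z ∈ C, m' z ∈ C ∧ m z ∈ C := fun z hz => (hCcl z hz).symm
  have h2 : 0 ≤ ∑ z ∈ C, flipGain w m' z (m (m' z)) := Finset.sum_nonneg fun z hz => by
    have := h.swap.flipGain_nonpos_of_splits hCcl' (fun z hz => (hCd z hz).symm) (by omega) hyC
      hy.symm hz (hr.closed C hCcl z hz).2 (hr.adj_swap hCcl hadj z hz)
      (hr.swap.adj_left hCcl' (hr.adj_swap hCcl hadj) z hz) (h.left.ne _)
    rw [flipGain_neg] at this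
    linarith
  have h3 := hr.sum_flipGain_sub h.left h.right hCcl w
  linarith

theorem MinimalGap.not_splits (h : MinimalGap G w K m m') (hG : ChordProperty G) :
    ¬ Splits m m' := by
  rintro ⟨S, hS, ⟨x, hxS, hx⟩, y, hyS, hy⟩
  have hScl := closed_compl h.left h.right hS
  have h1 := h.gapOn_lt_five hG hS hxS hx hyS hy
  have h2 := h.gapOn_lt_five hG hScl (Finset.mem_compl.2 hyS) hy (by simpa using hxS) hx
  have h3 := h.not_dvd_gapOn hS hxS hx hyS hy
  have h4 := h.not_dvd_gapOn hScl (Finset.mem_compl.2 hyS) hy (by simpa using hxS) hx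
  have h5 := two_dvd_gapOn h.left h.right hS w
  have h6 := two_dvd_gapOn h.left h.right hScl w
  have h7 := gapOn_add_compl w m m' S
  have h8 := h.lo_add_four_le
  have h9 := h.add_four_le_hi
  omega

/-- If the difference is a single cycle, it has no two adjacent odd chords. -/
theorem MinimalGap.false_of_adjacent_chords (h : MinimalGap G w K m m') (hns : ¬ Splits m m')
    {v : V} {n d : ℕ} (hv : m v ≠ m' v) (hper : IsAltPeriod m m' v n) (hd : Odd d) (hd3 : 3 ≤ d)
    (hdn : d + 5 ≤ n) (he : G.Adj v (altSeq m m' v d))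
    (hf : G.Adj (altSeq m m' v (d + 1)) (altSeq m m' v (n - 1))) : False := by
  have hm := h.left
  have hm' := h.right
  set p := altSeq m m' v with hp
  have hd1 : Even (d + 1) := hd.add_one
  have hneven := hper.even
  have hper' : IsAltPeriod m m' (p (d + 1)) n := by
    have := hper.shift (d + 1)
    rwa [if_pos hd1] at this
  have hp' : ∀ k, altSeq m m' (p (d + 1)) k = p (d + 1 + k) := fun k => by
    have := altSeq_add (m := m) (m' := m') v (d + 1) k
    rw [if_pos hd1] at this
    exact this.symm
  have hn1 : Odd (n - 1) := Nat.Even.sub_odd (by omega) hneven odd_one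
  have hd' : Odd (n - d - 2) := by
    rw [Nat.odd_iff] at hd ⊢
    rw [Nat.even_iff] at hneven
    omega
  have hm'v : m' v = p (n - 1) := by
    have h1 : m' (p (n - 1 + 1)) = p (n - 1) := right_altSeq_even hm' v hn1
    rw [Nat.sub_add_cancel (by omega)] at h1
    have h2 : p n = v := by
      have := hper.add_period 0
      rwa [Nat.zero_add] at this
    rwa [h2] at h1
  have hm'd : m' (p d) = p (d + 1) := (altSeq_succ_of_odd v hd).symm
  have hpn : ∀ i, p (i + n) = p i := hper.add_period
  have hinj : ∀ i j, i < n → j < n → i ≠ j → p i ≠ p j := fun i j hi hj hij e =>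
    hij (hper.inj i j hi hj e)
  have hf' : G.Adj (p (d + 1)) (altSeq m m' (p (d + 1)) (n - d - 2)) := by
    rw [hp', show d + 1 + (n - d - 2) = n - 1 by omega]
    exact hf
  have hne : p d ≠ m' v := by
    rw [hm'v]
    exact hinj _ _ (by omega) (by omega) (by omega)
  have hQ : IsMateMap G (flipMate m' v (p d)) := hm'.flipMate he (by rw [hm'v, hm'd]; exact hf.symm) hne
  have hQw := hm'.mateWeight_flipMate he.ne hne w
  have hE := hper.isMateMap_chordMate hm hm' hd (by omega) he
  have hF := hper'.isMateMap_chordMate hm hm' hd' (by omega) hf'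
  have hE4 := h.not_dvd_chordMate hv hper hd hd3 (by omega) he
  have hF4 : ¬ (4 : ℤ) ∣ mateWeight w (chordMate m m' (p (d + 1)) (n - d - 2)) - K :=
    h.not_dvd_chordMate (altSeq_diff hm hm' hv (d + 1)) hper' hd' (by omega) (by omega) hf'
  have hQv : flipMate m' v (p d) v = p d := by simp [flipMate]
  have hQd : flipMate m' v (p d) (p d) = v := by simp [flipMate, he.ne']
  have hQj : ∀ j, j < n → j ≠ 0 → j ≠ d → j ≠ d + 1 → j ≠ n - 1 →
      flipMate m' v (p d) (p j) = m' (p j) := by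
    intro j hj h0 h1 h2 h3
    apply flipMate_of_ne
    · exact hinj j 0 hj (by omega) h0
    · exact hinj j d hj (by omega) h1
    · rw [hm'v]
      exact hinj j _ hj (by omega) h3
    · rw [hm'd]
      exact hinj j _ hj (by omega) h2
  have hFv : ∀ j, j ≤ d → chordMate m m' (p (d + 1)) (n - d - 2) (p j) = m (p j) := by
    intro j hj
    have := hper'.chordMate_altSeq (d := n - d - 2) (by omega) (j := j + n - (d + 1)) (by omega)
    rw [if_neg (by omega), if_neg (by omega), if_neg (by omega), hp',
      show d + 1 + (j + n - (d + 1)) = j + n by omega, hpn] at this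
    exact this
  have hag : ∀ x, m x = m' x → flipMate m' v (p d) x = m x := fun x hx => by
    rw [flipMate_of_eq hm' hm hv.symm (altSeq_diff hm hm' hv d).symm hx.symm, hx]
  have hpt : ∀ x, w s(x, flipMate m' v (p d) x) + w s(x, m x) =
      w s(x, chordMate m m' v d x) + w s(x, chordMate m m' (p (d + 1)) (n - d - 2) x) := by
    intro x
    by_cases hx : m x = m' x
    · rw [hag x hx, chordMate_of_eq hm hm' hv hx,
        chordMate_of_eq hm hm' (altSeq_diff hm hm' hv (d + 1)) hx]
    have hxC : x ∈ altSet m m' v n := by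
      by_contra hxC
      exact hns ⟨_, fun z hz => hper.apply_mem_altSet hm.invol hm'.invol hz,
        ⟨v, hper.mem_altSet 0, hv⟩, x, hxC, hx⟩
    obtain ⟨j, hj, rfl⟩ := Finset.mem_image.1 hxC
    rw [Finset.mem_range] at hj
    change w s(p j, flipMate m' v (p d) (p j)) + w s(p j, m (p j)) =
      w s(p j, chordMate m m' v d (p j)) +
        w s(p j, chordMate m m' (p (d + 1)) (n - d - 2) (p j))
    have hEj := hper.chordMate_altSeq (d := d) (by omega) hj
    rw [← hp] at hEj
    by_cases hjd : j ≤ d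
    · rw [hFv j hjd]
      have : flipMate m' v (p d) (p j) = chordMate m m' v d (p j) := by
        rw [hEj]
        split_ifs with h0 h1 h2
        · rw [h0]
          exact hQv
        · rw [h1]
          exact hQd
        · exact hQj j hj h0 h1 (by omega) (by omega)
        · omega
      rw [this]
    · rw [if_neg (by omega), if_neg (by omega), if_neg (by omega)] at hEj
      rw [hEj]
      have hFj := hper'.chordMate_altSeq (d := n - d - 2) (by omega) (j := j - (d + 1)) (by omega)
      rw [hp', show d + 1 + (j - (d + 1)) = j by omega, hp',
        show d + 1 + (n - d - 2) = n - 1 by omega] at hFj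
      have : flipMate m' v (p d) (p j) = chordMate m m' (p (d + 1)) (n - d - 2) (p j) := by
        rw [hFj]
        split_ifs with h0 h1 h2
        · rw [show j = d + 1 by omega, ← hm'v, ← hm'd]
          have h1 : m' (p d) ≠ v := fun e => hne (by rw [← e, hm'.invol])
          have h2 : m' (p d) ≠ m' v := fun e => he.ne' (hm'.injective e)
          simp [flipMate, h1, hm'.ne, h2]
        · rw [show j = n - 1 by omega, ← hm'v, ← hm'd]
          simp [flipMate, hm'.ne, hne.symm]
        · exact hQj j hj (by omega) (by omega) (by omega) (by omega)
        · omega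
      rw [this]
      ring
  have hsum : mateWeight w (flipMate m' v (p d)) + mateWeight w m =
      mateWeight w (chordMate m m' v d) +
        mateWeight w (chordMate m m' (p (d + 1)) (n - d - 2)) := by
    simp only [mateWeight, ← Finset.sum_add_distrib]
    exact Finset.sum_congr rfl fun x _ => hpt x
  have hE2 := hE.even_mateWeight w
  have hF2 := hF.even_mateWeight w
  have hm2 := hm.even_mateWeight w
  have hdl := h.dvd_left
  have hlt := h.lt_of_splits hQ hag hns (fun hdiff => ?_) (by omega)
  · have := (flipGain_bounds (m := m') h.unit v (p d)).1
    have := h.add_four_le_hi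
    omega
  · have hmemS : ∀ j, j ≤ d → p j ∈ (Finset.range (d + 1)).image p := fun j hj =>
      Finset.mem_image_of_mem p (Finset.mem_range.2 (by omega))
    refine ⟨(Finset.range (d + 1)).image p, fun x hx => ?_, ⟨v, hmemS 0 (by omega), ?_⟩,
      ⟨p (d + 1), fun hx => ?_, ?_⟩⟩
    · obtain ⟨j, hj, rfl⟩ := Finset.mem_image.1 hx
      rw [Finset.mem_range] at hj
      have hcases : (Even j ∧ j + 1 ≤ d) ∨ ∃ l, j = l + 1 ∧ Even l := by
        rcases Nat.even_or_odd j with hev | ⟨l, hl⟩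
        · rw [Nat.odd_iff] at hd
          rw [Nat.even_iff] at hev
          exact Or.inl ⟨Nat.even_iff.2 hev, by omega⟩
        · exact Or.inr ⟨2 * l, hl, by simp⟩
      constructor
      · rcases hcases with ⟨hev, hj1⟩ | ⟨l, rfl, hl⟩
        · rw [← show p (j + 1) = m (p j) from altSeq_succ_of_even v hev]
          exact hmemS _ hj1
        · rw [show m (p (l + 1)) = p l from left_altSeq_odd hm v hl]
          exact hmemS _ (by omega)
      · by_cases h0 : j = 0
        · rw [h0, show p 0 = v from rfl, hQv]
          exact hmemS d le_rfl
        by_cases h1 : j = d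
        · rw [h1, hQd]
          exact hmemS 0 (by omega)
        rw [hQj j (by omega) h0 h1 (by omega) (by omega)]
        rcases hcases with ⟨hev, hj1⟩ | ⟨l, rfl, hl⟩
        · obtain ⟨l, rfl⟩ : ∃ l, j = l + 1 := ⟨j - 1, by omega⟩
          have hl : Odd l := by simpa [Nat.even_add_one] using hev
          rw [show m' (p (l + 1)) = p l from right_altSeq_even hm' v hl]
          exact hmemS _ (by omega)
        · rw [← show p (l + 1 + 1) = m' (p (l + 1)) from altSeq_succ_of_odd v hl.add_one]
          exact hmemS _ (by omega)
    · rw [← mem_diffSet, hdiff, mem_diffSet]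
      exact hv
    · obtain ⟨j, hj, e⟩ := Finset.mem_image.1 hx
      rw [Finset.mem_range] at hj
      exact hinj j (d + 1) (by omega) (by omega) (by omega) e
    · rw [← mem_diffSet, hdiff, mem_diffSet]
      exact altSeq_diff hm hm' hv (d + 1)

/-- A rotation along chords of a single cycle: the total gain of its flips is less than `8`. -/
theorem MinimalGap.sum_flipGain_lt (h : MinimalGap G w K m m') (hns : ¬ Splits m m')
    {τ τ' : V → V} (hr : IsRotation m m' τ τ') {C : Finset V}
    (hC : ∀ x ∈ C, m x ∈ C ∧ m' x ∈ C) (hCd : ∀ x ∈ C, m x ≠ m' x)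
    (hadj : ∀ x ∈ C, G.Adj x (τ x)) (hne : ∀ x, τ x ≠ m x) :
    ∑ x ∈ C, flipGain w m x (τ x) < 8 := by
  have hm := h.left
  have hτC := fun x hx => (hr.closed C hC x hx).1
  have hadj' := hr.adj_left hC hadj
  have hmate := fun x hx => hm.flipMate (hadj x hx) (hadj' x hx) (hne x)
  have hwt := fun x hx => hm.mateWeight_flipMate (hadj x hx).ne (hne x) w
  have hag : ∀ x ∈ C, ∀ u, m u = m' u → flipMate m x (τ x) u = m u := fun x hx u hu =>
    flipMate_of_eq hm h.right (hCd x hx) (hCd _ (hτC x hx)) hu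
  have hle1 : ∀ x ∈ C, flipGain w m x (τ x) ≤ 1 := by
    intro x hx
    by_contra! hgt
    have := (flipGain_bounds (m := m) h.unit x (τ x)).2
    exact h.mateWeight_ne_add_four (hmate x hx) (hag x hx) (fun hs => absurd hs hns)
      (by rw [hwt x hx]; omega)
  by_contra! hsum
  set T := C.filter fun x => flipGain w m x (τ x) = 1 with hT
  have hTcard : 8 ≤ T.card := by
    have : ∑ x ∈ C, flipGain w m x (τ x) ≤ ∑ x ∈ C, if flipGain w m x (τ x) = 1 then 1 else 0 := by
      refine Finset.sum_le_sum fun x hx => ?_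
      have := hle1 x hx
      split_ifs <;> omega
    rw [Finset.sum_boole] at this
    exact_mod_cast hsum.trans this
  obtain ⟨u, hu⟩ : T.Nonempty := Finset.card_pos.1 (by omega)
  obtain ⟨x, hxT, hx⟩ := Finset.exists_mem_notMem_of_card_lt_card
    (s := {u, m u, τ u, m (τ u), τ' u, m (τ (τ u))}) (t := T)
    (Finset.card_le_six.trans_lt (by omega))
  simp only [Finset.mem_insert, Finset.mem_singleton, not_or] at hx
  obtain ⟨hx1, hx2, hx3, hx4, hx5, hx6⟩ := hx
  obtain ⟨huC, hu1⟩ := Finset.mem_filter.1 hu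
  obtain ⟨hxC, hxg⟩ := Finset.mem_filter.1 hxT
  have hfx : flipMate m u (τ u) x = m x := flipMate_of_ne hx1 hx3 hx2 hx4
  have hfτ : flipMate m u (τ u) (τ x) = m (τ x) := by
    apply flipMate_of_ne
    · intro e
      exact hx5 (by rw [← e, hr.left_inv])
    · intro e
      exact hx1 (by rw [← hr.left_inv x, e, hr.left_inv])
    · intro e
      exact hx4 (by rw [hr.left_comm, ← e, hr.left_inv])
    · intro e
      exact hx6 (by rw [hr.left_comm, ← e, hr.left_inv])
  have hN := (hmate u huC).flipMate (hadj x hxC) (by rw [hfx, hfτ]; exact hadj' x hxC)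
    (by rw [hfx]; exact hne x)
  have hNw := (hmate u huC).mateWeight_flipMate (hadj x hxC).ne (by rw [hfx]; exact hne x) w
  have hgain : flipGain w (flipMate m u (τ u)) x (τ x) = flipGain w m x (τ x) := by
    simp only [flipGain, hfx, hfτ]
  refine h.mateWeight_ne_add_four hN (fun z hz => ?_) (fun hs => absurd hs hns)
    (by rw [hNw, hgain, hwt u huC, hxg, hu1]; ring)
  have hτx := hτC x hxC
  have hzC : z ∉ C := fun hzC => hCd z hzC hz
  rw [flipMate_of_ne, hag u huC z hz]
  · exact fun e => hzC (e ▸ hxC)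
  · exact fun e => hzC (e ▸ hτx)
  · rw [hfx]
    exact fun e => hzC (e ▸ (hC x hxC).1)
  · rw [hfτ]
    exact fun e => hzC (e ▸ (hC _ hτx).1)

theorem MinimalGap.false (h : MinimalGap G w K m m') (hG : ChordProperty G) : False := by
  have hm := h.left
  have hm' := h.right
  have hns := h.not_splits hG
  have hlo := h.lo_add_four_le
  have hhi := h.add_four_le_hi
  obtain ⟨v, hv⟩ : ∃ v, m v ≠ m' v := by
    by_contra! hall
    have : m = m' := funext hall
    rw [this] at hlo
    omega
  obtain ⟨n, hper⟩ := exists_isAltPeriod hm.invol_ne hm'.invol_ne v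
  set C := altSet m m' v n with hC
  have hCcl : ∀ z ∈ C, m z ∈ C ∧ m' z ∈ C := fun z hz =>
    hper.apply_mem_altSet hm.invol hm'.invol hz
  have hCcl' : ∀ z ∈ C, m' z ∈ C ∧ m z ∈ C := fun z hz => (hCcl z hz).symm
  have hvC : v ∈ C := hper.mem_altSet 0
  have hCd : ∀ z ∈ C, m z ≠ m' z := by
    intro z hz
    obtain ⟨i, -, rfl⟩ := Finset.mem_image.1 hz
    exact altSeq_diff hm hm' hv i
  have hgap : 8 ≤ gapOn w m m' C := by
    have h0 : gapOn w m m' Cᶜ = 0 := Finset.sum_eq_zero fun z hz => by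
      by_contra hne
      exact hns ⟨C, hCcl, ⟨v, hvC, hv⟩, z, Finset.mem_compl.1 hz, fun e => hne (by rw [e, sub_self])⟩
    have := gapOn_add_compl w m m' C
    omega
  have hn : 8 ≤ n := by
    have h1 := gapOn_le_card (m := m) (m' := m') h.unit C
    have h2 : C.card = n := hper.card_altSet
    omega
  obtain ⟨W, hW, hlen, hvtx, hedge⟩ := hper.exists_isCycle hm hm' (by omega)
  have hr := isRotation_two hm hm'
  have hadj : ∀ z ∈ C, G.Adj z (m' (m (m' (m z)))) := by
    rcases hG.2 v W hW (hlen ▸ hper.even) (hlen ▸ hn) with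
      ⟨i, d, hd1, hdn, ⟨hadj, hch⟩, hdodd, ⟨hadj', hch'⟩, -⟩ | hall
    · exfalso
      rw [hlen] at hdn hdodd hadj' hch'
      rw [hvtx, hvtx] at hadj hch hadj' hch'
      have hneven := hper.even
      have hd : Odd d := by
        rw [Nat.odd_iff, Nat.odd_iff] at hdodd
        rw [Nat.even_iff] at hneven
        rw [Nat.odd_iff]
        omega
      have hodd1 : Odd (i + d + 1 - (i + 1)) := by
        rwa [show i + d + 1 - (i + 1) = d by omega]
      have hodd2 : Odd (i + n - 1 + 1 - (i + d + 1 + 1)) := by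
        rw [Nat.odd_iff] at hd ⊢
        rw [Nat.even_iff] at hneven
        omega
      have h3 := three_le_of_chord hper hedge (by omega) hodd1 hch (by omega)
      have h4 := three_le_of_chord hper hedge (by omega) hodd2 hch' (by omega)
      have hsh := hper.shift (i + 1)
      have hadd := altSeq_add (m := m) (m' := m') v (i + 1)
      have hmemd := hCd _ (altSeq_mem v hCcl hvC (i + 1))
      rw [show i + d + 1 = i + 1 + d by ring, hadd] at hadj
      rw [show i + d + 1 + 1 = i + 1 + (d + 1) by ring, hadd,
        show i + n - 1 + 1 = i + 1 + (n - 1) by omega, hadd] at hadj'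
      split_ifs at hsh hadj hadj'
      · exact h.false_of_adjacent_chords hns hmemd hsh hd (by omega) (by omega) hadj hadj'
      · exact h.swap.false_of_adjacent_chords (fun hs => hns (splits_comm.1 hs)) hmemd.symm hsh hd
          (by omega) (by omega) hadj hadj'
    · refine hper.adj_rotation (k := 4) hr (by omega) (by decide)
        (fun u => ?_) (fun u => ?_)
        (hper.adj_rotate (by omega) (by omega) fun i j hij hj hd => ?_)
      · simp [altSeq, Nat.even_iff]
      · simp [altSeq, Nat.even_iff]
      · have := hall i j hij (by omega) (by
          rcases hd with hd | hd
          · rw [hd]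
            decide
          · rw [hd, Nat.even_sub (by omega)]
            simp only [hper.even, true_iff]
            decide) (by omega) (by omega)
        rwa [hvtx, hvtx] at this
  have h1 := h.sum_flipGain_lt hns hr hCcl hCd hadj fun z e => by
    have := altSeq_odd_ne hm'.invol_ne hm.invol_ne (m z) 1
    simp [altSeq, Nat.even_iff, e] at this
  have h2 := h.swap.sum_flipGain_lt (fun hs => hns (splits_comm.1 hs)) hr.swap hCcl'
    (fun z hz => (hCd z hz).symm) (hr.adj_swap hCcl hadj) fun z e => by
      have := altSeq_odd_ne hm.invol_ne hm'.invol_ne (m' z) 1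
      simp [altSeq, Nat.even_iff, e] at this
  simp only [flipGain_neg, Finset.sum_neg_distrib] at h2
  have h3 := hr.sum_flipGain_sub hm hm' hCcl w
  omega

/-- Matchings attain every intermediate weight congruent to the extreme ones. -/
theorem Straddle.exists_mateWeight_eq (h : Straddle G w K m m') (hG : ChordProperty G)
    (hw : ∀ e f, w e ≤ w f + 1) : ∃ N, IsMateMap G N ∧ mateWeight w N = K := by
  by_contra! hskip
  have wf : WellFounded fun a b : (V → V) × (V → V) =>
      gapMeasure w a.1 a.2 < gapMeasure w b.1 b.2 :=
    InvImage.wf (fun a : (V → V) × (V → V) => gapMeasure w a.1 a.2) wellFounded_lt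
  obtain ⟨⟨a, a'⟩, ha, hmin⟩ := wf.has_min {b | Straddle G w K b.1 b.2} ⟨(m, m'), h⟩
  exact MinimalGap.false (m := a) (m' := a')
    ⟨ha, hw, hskip, fun b b' hb => hmin (b, b') hb⟩ hG

end MateMap

section PerfectMatching

variable {G : SimpleGraph V}

theorem mateWeight_eq_two_mul_redCount (c : Sym2 V → Bool) {m : V → V}
    {M : Finset (Sym2 V)} (hM : IsPM G M) (h : ∀ v, s(v, m v) ∈ M) :
    mateWeight (fun e => if c e then 1 else 0) m = 2 * redCount c M := by
  have hmem : ∀ e ∈ M, ∀ v ∈ e, s(v, m v) = e := fun e he v hv =>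
    (hM.2 v).unique ⟨h v, Sym2.mem_mk_left _ _⟩ ⟨he, hv⟩
  have hmap : ∀ v ∈ (Finset.univ : Finset V), s(v, m v) ∈ M := fun v _ => h v
  rw [mateWeight, ← Finset.sum_fiberwise_of_maps_to hmap, redCount, Finset.card_filter,
    Nat.cast_sum, Finset.mul_sum]
  refine Finset.sum_congr rfl fun e he => ?_
  have hfib : (Finset.univ.filter fun v => s(v, m v) = e) = e.toFinset := by
    ext v
    simp only [Finset.mem_filter, Finset.mem_univ, true_and, Sym2.mem_toFinset]
    exact ⟨fun hv => hv ▸ Sym2.mem_mk_left _ _, hmem e he v⟩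
  rw [Finset.sum_congr rfl fun v hv => by rw [(Finset.mem_filter.1 hv).2], Finset.sum_const, hfib,
    Sym2.card_toFinset_of_not_isDiag e (G.not_isDiag_of_mem_edgeSet (hM.1 e he))]
  simp

theorem IsPM.exists_isMateMap {M : Finset (Sym2 V)} (hM : IsPM G M) :
    ∃ m, IsMateMap G m ∧ ∀ v, s(v, m v) ∈ M := by
  have hex : ∀ v, ∃ u, s(v, u) ∈ M := fun v => by
    obtain ⟨e, ⟨he, u, rfl⟩, -⟩ := hM.2 v
    exact ⟨u, he⟩
  choose m hm using hex
  refine ⟨m, fun v => ⟨?_, hM.1 _ (hm v)⟩, hm⟩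
  have := (hM.2 (m v)).unique ⟨hm (m v), Sym2.mem_mk_left _ _⟩ ⟨hm v, Sym2.mem_mk_right _ _⟩
  rw [Sym2.eq_swap] at this
  exact Sym2.congr_left.1 this

theorem IsMateMap.exists_isPM {m : V → V} (hm : IsMateMap G m) :
    ∃ M, IsPM G M ∧ ∀ v, s(v, m v) ∈ M := by
  refine ⟨Finset.univ.image fun v => s(v, m v), ⟨fun e he => ?_, fun v => ?_⟩, fun v =>
    Finset.mem_image_of_mem _ (Finset.mem_univ v)⟩
  · obtain ⟨v, -, rfl⟩ := Finset.mem_image.1 he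
    exact hm.adj v
  · refine ⟨s(v, m v), ⟨Finset.mem_image_of_mem _ (Finset.mem_univ v), Sym2.mem_mk_left _ _⟩, ?_⟩
    rintro e ⟨he, hv⟩
    obtain ⟨u, -, rfl⟩ := Finset.mem_image.1 he
    rcases Sym2.mem_iff.1 hv with rfl | rfl
    · rfl
    · rw [hm.invol, Sym2.eq_swap]

end PerfectMatching

/-- if `G` satisfies the chord property then `(G, c)` satisfies
Karzanov's property, for every red-blue coloring `c`. -/
theorem stmt_18 (G : SimpleGraph V) (c : Sym2 V → Bool)
    (hchord : ChordProperty G) : Karzanov G c := by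
  intro M M' hM hM' k hk hk' hpar hpar'
  obtain ⟨m, hm, hmM⟩ := hM.exists_isMateMap
  obtain ⟨m', hm', hmM'⟩ := hM'.exists_isMateMap
  have h1 := mateWeight_eq_two_mul_redCount c hM hmM
  have h2 := mateWeight_eq_two_mul_redCount c hM' hmM'
  have hS : Straddle G (fun e => if c e then 1 else 0) (2 * k) m m' :=
    ⟨hm, hm', by omega, by omega, by omega, by omega⟩
  obtain ⟨N, hN, hNw⟩ := hS.exists_mateWeight_eq hchord fun e f => by
    split_ifs <;> norm_num
  obtain ⟨M'', hM'', hNM⟩ := hN.exists_isPM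
  have h3 := mateWeight_eq_two_mul_redCount c hM'' hNM
  exact ⟨M'', hM'', by omega⟩
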